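/- Let A be a J-algebra and a, b ∈ A. If a and b are functional and 1 = a˘;b, then the pairing identity holds for a and b: for all u, v, x, y ∈ A, (u;v)·(x;y) = ((u;a˘)·(x;b˘));((a;v)·(b;y)). -/

import Mathlib

/-- A J-algebra: an algebra (A, ·, 0, 1, ;, ˘, 1') satisfying Jónsson's axioms. -/
structure JAlgebra (A : Type*) where
  meet : A → A → A        -- Boolean product ·
  comp : A → A → A        -- relative product ;
  conv : A → A            -- converse ˘
  zero : A                -- 0
  one : A                 -- 1
  ident : A               -- 1'
  massoc : ∀ x y z, meet x (meet y z) = meet (meet x y) z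
  mcomm : ∀ x y, meet x y = meet y x
  midem : ∀ x, meet x x = x
  cassoc : ∀ x y z, comp x (comp y z) = comp (comp x y) z
  cid : ∀ x, comp x ident = x
  semidist : ∀ x y z, comp (meet x y) z = meet (comp (meet x y) z) (comp y z)
  convconv : ∀ x, conv (conv x) = x
  convcomp : ∀ x y, conv (comp x y) = comp (conv y) (conv x)
  convmeet : ∀ x y, conv (meet x y) = meet (conv x) (conv y)
  rot : ∀ x y z, meet (comp x y) z =
    meet (comp (meet (comp z (conv y)) x) (meet y (comp (conv x) z))) z
  zbot : ∀ x, meet zero x = zero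
  otop : ∀ x, meet x one = x
  comp_zero : ∀ x, comp x zero = zero

/-- x ≤ y iff x·y = x. -/
def JAlgebra.le {A : Type*} (J : JAlgebra A) (x y : A) : Prop := J.meet x y = x

/-- x is functional iff x˘;x ≤ 1'. -/
def JAlgebra.Functional {A : Type*} (J : JAlgebra A) (x : A) : Prop :=
  J.le (J.comp (J.conv x) x) J.ident

/-- x is permutational iff x;x˘ = 1' = x˘;x. -/
def JAlgebra.Permutational {A : Type*} (J : JAlgebra A) (x : A) : Prop :=
  J.comp x (J.conv x) = J.ident ∧ J.comp (J.conv x) x = J.ident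

namespace JAlgebra

variable {A : Type*} (J : JAlgebra A) {x y z w : A}

theorem le_trans' (h₁ : J.le x y) (h₂ : J.le y z) : J.le x z := by
  unfold le at *
  rw [← h₁, ← J.massoc, h₂]

theorem le_antisymm' (h₁ : J.le x y) (h₂ : J.le y x) : x = y := by
  unfold le at *
  rw [← h₁, J.mcomm, h₂]

theorem meet_le_left (x y : A) : J.le (J.meet x y) x := by
  unfold le
  rw [J.mcomm, J.massoc, J.midem]

theorem meet_le_right (x y : A) : J.le (J.meet x y) y := by
  unfold le
  rw [← J.massoc, J.midem]

theorem le_meet (h₁ : J.le x y) (h₂ : J.le x z) : J.le x (J.meet y z) := by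
  unfold le at *
  rw [J.massoc, h₁, h₂]

theorem conv_mono (h : J.le x y) : J.le (J.conv x) (J.conv y) := by
  unfold le at *
  rw [← J.convmeet, h]

theorem comp_mono_left (z : A) (h : J.le x y) : J.le (J.comp x z) (J.comp y z) := by
  unfold le at *
  have := J.semidist x y z
  rw [h] at this
  exact this.symm

theorem comp_mono_right (z : A) (h : J.le x y) : J.le (J.comp z x) (J.comp z y) := by
  have := J.conv_mono (J.comp_mono_left (J.conv z) (J.conv_mono h))
  simpa only [J.convcomp, J.convconv] using this

theorem comp_mono (h₁ : J.le x y) (h₂ : J.le z w) : J.le (J.comp x z) (J.comp y w) :=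
  J.le_trans' (J.comp_mono_left z h₁) (J.comp_mono_right y h₂)

theorem conv_ident_comp (x : A) : J.comp (J.conv J.ident) x = x := by
  rw [← J.convconv x, ← J.convcomp, J.cid]

theorem conv_ident : J.conv J.ident = J.ident := by
  rw [← J.cid (J.conv J.ident), J.conv_ident_comp]

theorem ident_comp (x : A) : J.comp J.ident x = x := by
  rw [← J.conv_ident, J.conv_ident_comp]

theorem dedekind (x y z : A) :
    J.le (J.meet (J.comp x y) z)
      (J.comp (J.meet (J.comp z (J.conv y)) x) (J.meet y (J.comp (J.conv x) z))) := by
  rw [J.rot]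
  exact J.meet_le_left _ _

theorem le_comp_conv_of_le_ident (h₁ : J.le z J.ident) (h₂ : J.le z (J.comp x y)) :
    J.le z (J.comp (J.meet x (J.conv y)) (J.conv (J.meet x (J.conv y)))) := by
  have h := J.le_trans' (J.le_meet h₂ h₁) (J.dedekind x y J.ident)
  rwa [J.ident_comp, J.cid, J.mcomm (J.conv y), J.mcomm y,
    show J.meet (J.conv x) y = J.conv (J.meet x (J.conv y)) by
      rw [J.convmeet, J.convconv]] at h

theorem le_comp_subident_comp (h : J.le z (J.comp x y)) :
    J.le z (J.comp x (J.comp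
      (J.meet J.ident (J.comp (J.conv x) (J.comp z (J.conv y)))) y)) := by
  have h₁ : J.le z (J.comp (J.meet (J.comp z (J.conv y)) x) y) :=
    J.le_trans' (J.le_trans' (J.le_meet h (J.midem z)) (J.dedekind x y z))
      (J.comp_mono_right _ (J.meet_le_left _ _))
  have h₂ : J.le (J.meet (J.comp z (J.conv y)) x)
      (J.comp x (J.meet J.ident (J.comp (J.conv x) (J.comp z (J.conv y))))) := by
    have := J.dedekind x J.ident (J.comp z (J.conv y))
    rw [J.cid, J.mcomm] at this
    exact J.le_trans' this (J.comp_mono_left _ (J.meet_le_right _ _))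
  rw [J.cassoc]
  exact J.le_trans' h₁ (J.comp_mono_left _ h₂)

variable {J}

theorem Functional.conv_comp_comp_le {a : A} (ha : J.Functional a) (x : A) :
    J.le (J.comp (J.conv a) (J.comp a x)) x := by
  have := J.comp_mono_left x ha
  rwa [J.ident_comp, ← J.cassoc] at this

theorem Functional.comp_conv_comp_le {a : A} (ha : J.Functional a) (x : A) :
    J.le (J.comp (J.comp x (J.conv a)) a) x := by
  have := J.comp_mono_right x ha
  rwa [J.cid, J.cassoc] at this

/-- A subidentity element below two cycles factors through the pairing of their midpoints. -/
theorem le_comp_conv_of_pairing {a b e p q r s : A} (hQ : J.one = J.comp (J.conv a) b)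
    (he : J.le e J.ident) (hpq : J.le e (J.comp p q)) (hrs : J.le e (J.comp r s)) :
    ∃ w, J.le e (J.comp w (J.conv w)) ∧
      J.le w (J.comp p (J.conv a)) ∧ J.le w (J.comp (J.conv q) (J.conv a)) ∧
      J.le w (J.comp r (J.conv b)) ∧ J.le w (J.comp (J.conv s) (J.conv b)) := by
  have hM := J.le_comp_conv_of_le_ident he hpq
  have hN := J.le_comp_conv_of_le_ident he hrs
  have hMp := J.meet_le_left p (J.conv q)
  have hMq := J.meet_le_right p (J.conv q)
  have hNr := J.meet_le_left r (J.conv s)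
  have hNs := J.meet_le_right r (J.conv s)
  generalize J.meet p (J.conv q) = m at *
  generalize J.meet r (J.conv s) = n at *
  have hsq : J.le e (J.comp e (J.conv e)) := by
    have h := J.le_comp_conv_of_le_ident (x := e) (y := J.ident) he
      (by rw [J.cid]; exact J.midem e)
    have h' := J.meet_le_left e (J.conv J.ident)
    exact J.le_trans' h (J.comp_mono h' (J.conv_mono h'))
  have hN' := J.conv_mono hN
  rw [J.convcomp, J.convconv] at hN'
  have hmn : J.le e (J.comp (J.comp m (J.conv a)) (J.comp b (J.conv n))) := by
    have h := J.le_trans' hsq (J.comp_mono hM hN')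
    have h1 : J.le (J.comp (J.conv m) n) (J.comp (J.conv a) b) := hQ ▸ J.otop _
    have h2 := J.comp_mono_right m (J.comp_mono_left (J.conv n) h1)
    simp only [J.cassoc] at h h2 ⊢
    exact J.le_trans' h h2
  have hwa := J.meet_le_left (J.comp m (J.conv a)) (J.conv (J.comp b (J.conv n)))
  have hwb := J.meet_le_right (J.comp m (J.conv a)) (J.conv (J.comp b (J.conv n)))
  refine ⟨_, J.le_comp_conv_of_le_ident he hmn, ?_, ?_, ?_, ?_⟩
  · exact J.le_trans' hwa (J.comp_mono_left _ hMp)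
  · exact J.le_trans' hwa (J.comp_mono_left _ hMq)
  all_goals
    rw [J.convcomp b, J.convconv] at hwb ⊢
  · exact J.le_trans' hwb (J.comp_mono_left _ hNr)
  · exact J.le_trans' hwb (J.comp_mono_left _ hNs)

end JAlgebra

/-- If a, b are functional and 1 = a˘;b, then the pairing identity holds:
(u;v)·(x;y) = ((u;a˘)·(x;b˘));((a;v)·(b;y)) for all u, v, x, y. -/
theorem pairing_identity {A : Type*} (J : JAlgebra A) (a b : A)
    (ha : J.Functional a) (hb : J.Functional b)
    (hQ : J.one = J.comp (J.conv a) b) :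
    ∀ u v x y : A,
      J.meet (J.comp u v) (J.comp x y) =
        J.comp (J.meet (J.comp u (J.conv a)) (J.comp x (J.conv b)))
               (J.meet (J.comp a v) (J.comp b y)) := by
  intro u v x y
  apply J.le_antisymm'
  · have hz := J.le_comp_subident_comp (x := J.conv a) (y := b)
      (hQ ▸ J.otop (J.meet (J.comp u v) (J.comp x y)))
    rw [J.convconv] at hz
    have he := J.meet_le_left J.ident
      (J.comp a (J.comp (J.meet (J.comp u v) (J.comp x y)) (J.conv b)))
    have he' := J.meet_le_right J.ident
      (J.comp a (J.comp (J.meet (J.comp u v) (J.comp x y)) (J.conv b)))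
    have huv := J.le_trans' he' (J.comp_mono_right a
      (J.comp_mono_left (J.conv b) (J.meet_le_left _ _)))
    have hxy := J.le_trans' he' (J.comp_mono_right a
      (J.comp_mono_left (J.conv b) (J.meet_le_right _ _)))
    generalize J.meet J.ident
      (J.comp a (J.comp (J.meet (J.comp u v) (J.comp x y)) (J.conv b))) = e at hz he huv hxy
    rw [← J.cassoc, J.cassoc] at huv hxy
    obtain ⟨w, hw, hu, hv, hx, hy⟩ := JAlgebra.le_comp_conv_of_pairing hQ he huv hxy
    refine J.le_trans' hz (J.le_trans' (J.comp_mono_right _ (J.comp_mono_left _ hw)) ?_)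
    rw [← J.cassoc w, J.cassoc (J.conv a)]
    rw [← J.cassoc] at hu hx
    have hv' := J.conv_mono hv
    have hy' := J.conv_mono hy
    simp only [J.convcomp, J.convconv] at hv' hy'
    rw [J.cassoc] at hv' hy'
    refine J.comp_mono (J.le_meet ?_ ?_) (J.le_meet ?_ ?_)
    · exact J.le_trans' (J.comp_mono_right _ hu) (ha.conv_comp_comp_le _)
    · exact J.le_trans' (J.comp_mono_right _ hx) (ha.conv_comp_comp_le _)
    · exact J.le_trans' (J.comp_mono_left _ hv') (hb.comp_conv_comp_le _)
    · exact J.le_trans' (J.comp_mono_left _ hy') (hb.comp_conv_comp_le _)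
  · apply J.le_meet
    · refine J.le_trans' (J.comp_mono (J.meet_le_left _ _) (J.meet_le_left _ _)) ?_
      rw [← J.cassoc]
      exact J.comp_mono_right u (ha.conv_comp_comp_le v)
    · refine J.le_trans' (J.comp_mono (J.meet_le_right _ _) (J.meet_le_right _ _)) ?_
      rw [← J.cassoc]
      exact J.comp_mono_right x (hb.conv_comp_comp_le y)
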